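/- Let μ, ν be finite measures on ℝ with finite first moments and μ ≤_E ν. Then the function h = P_ν - (P_ν - P_μ)^c is convex, satisfies P_μ ≤ h, belongs to 𝒟(μ(ℝ), \bar{μ}), and P_ν - h is convex; hence h = P_η for a unique measure η with μ ≤_cx η ≤ ν. -/

import Mathlib

open MeasureTheory Set Filter

noncomputable def pot (eta : Measure ℝ) (k : ℝ) : ℝ := ∫ x, max (k - x) 0 ∂eta

noncomputable def cpot (eta : Measure ℝ) (k : ℝ) : ℝ := ∫ x, max (x - k) 0 ∂eta

/-- `c` is the convex hull (largest convex minorant) of `f`. -/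
def IsConvexHull (f c : ℝ → ℝ) : Prop :=
  ConvexOn ℝ Set.univ c ∧ (∀ x, c x ≤ f x) ∧
    ∀ g : ℝ → ℝ, ConvexOn ℝ Set.univ g → (∀ x, g x ≤ f x) → ∀ x, g x ≤ c x

/-- Convex order: `∫ f dη ≤ ∫ f dχ` for all convex `f` for which both integrals exist. -/
def Cx (eta chi : Measure ℝ) : Prop :=
  ∀ f : ℝ → ℝ, ConvexOn ℝ Set.univ f → Integrable f eta → Integrable f chi →
    ∫ x, f x ∂eta ≤ ∫ x, f x ∂chi

/-- Extended convex order: `∫ f dη ≤ ∫ f dχ` for all nonnegative convex `f`. -/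
def ECx (eta chi : Measure ℝ) : Prop :=
  ∀ f : ℝ → ℝ, ConvexOn ℝ Set.univ f → (∀ x, 0 ≤ f x) →
    ∫⁻ x, ENNReal.ofReal (f x) ∂eta ≤ ∫⁻ x, ENNReal.ofReal (f x) ∂chi

/-- The class `𝒟(a, b)`: nonnegative, nondecreasing, convex functions vanishing at `-∞`
and asymptotic to `a * z - b` at `+∞`. -/
def MemD (a b : ℝ) (f : ℝ → ℝ) : Prop :=
  ConvexOn ℝ Set.univ f ∧ Monotone f ∧ (∀ x, 0 ≤ f x) ∧
    Tendsto f atBot (nhds 0) ∧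
    Tendsto (fun z => f z - (a * z - b)) atTop (nhds 0)

/-- `S` is the shadow of `μ` in `ν`. -/
def IsShadow (mu nu S : Measure ℝ) : Prop :=
  Cx mu S ∧ S ≤ nu ∧ ∀ eta : Measure ℝ, Cx mu eta → eta ≤ nu → Cx S eta

/-- `T` is the counter-shadow of `μ` in `ν`. -/
def IsCounterShadow (mu nu T : Measure ℝ) : Prop :=
  Cx mu T ∧ T ≤ nu ∧ ∀ eta : Measure ℝ, Cx mu eta → eta ≤ nu → Cx eta T

/-! ### Convex functions on the line -/

/-- The right derivative. -/
noncomputable def rD (f : ℝ → ℝ) (x : ℝ) : ℝ := derivWithin f (Ioi x) x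

lemma conv_cont {f : ℝ → ℝ} (hf : ConvexOn ℝ univ f) : Continuous f :=
  continuousOn_univ.1 (hf.continuousOn isOpen_univ)

lemma rD_hasDeriv {f : ℝ → ℝ} (hf : ConvexOn ℝ univ f) (x : ℝ) :
    HasDerivWithinAt f (rD f x) (Ici x) x :=
  (hf.hasDerivWithinAt_rightDeriv_of_mem_interior (by simp)).Ici_of_Ioi

lemma rD_mono {f : ℝ → ℝ} (hf : ConvexOn ℝ univ f) : Monotone (rD f) := by
  intro x y hxy
  exact hf.monotoneOn_rightDeriv (by simp) (by simp) hxy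

lemma rD_le_slope {f : ℝ → ℝ} (hf : ConvexOn ℝ univ f) {x y : ℝ} (hxy : x < y) :
    rD f x ≤ slope f x y :=
  hf.rightDeriv_le_slope_of_mem_interior (by simp) (by simp) hxy

lemma rD_support {f : ℝ → ℝ} (hf : ConvexOn ℝ univ f) (w u : ℝ) :
    f w + rD f w * (u - w) ≤ f u := by
  rcases lt_trichotomy w u with h | h | h
  · have := rD_le_slope hf h
    rw [slope_def_field, le_div_iff₀ (by linarith)] at this
    linarith
  · subst h; simp
  · have h1 : slope f u w ≤ derivWithin f (Iio w) w :=
      hf.slope_le_leftDeriv_of_mem_interior (by simp) (by simp) h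
    have h2 := hf.leftDeriv_le_rightDeriv_of_mem_interior (x := w) (by simp)
    have h3 : slope f u w ≤ rD f w := h1.trans h2
    rw [slope_def_field, div_le_iff₀ (by linarith)] at h3
    linarith

lemma rD_rc {f : ℝ → ℝ} (hf : ConvexOn ℝ univ f) (x : ℝ) :
    ContinuousWithinAt (rD f) (Ici x) x := by
  have hs : Tendsto (slope f x) (nhdsWithin x (Ioi x)) (nhds (rD f x)) :=
    (hasDerivWithinAt_iff_tendsto_slope' self_notMem_Ioi).mp
      (hf.hasDerivWithinAt_rightDeriv_of_mem_interior (by simp))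
  unfold ContinuousWithinAt
  rw [tendsto_order]
  constructor
  · intro a ha
    filter_upwards [self_mem_nhdsWithin] with y hy
    exact ha.trans_le (rD_mono hf hy)
  · intro a ha
    have h1 := (hs.eventually (gt_mem_nhds ha)).and self_mem_nhdsWithin
    obtain ⟨y, hy, hxy⟩ := h1.exists
    have hxy : x < y := hxy
    have hc : ContinuousAt (fun z => (f y - f z) / (y - z)) x := by
      apply ContinuousAt.div
      · exact continuousAt_const.sub (conv_cont hf).continuousAt
      · exact (continuous_const.sub continuous_id).continuousAt
      · exact sub_ne_zero.2 hxy.ne'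
    have h2 : ∀ᶠ z in nhds x, (f y - f z) / (y - z) < a := by
      apply hc.eventually (gt_mem_nhds _)
      rwa [slope_def_field] at hy
    have h3 : ∀ᶠ z in nhds x, z < y := gt_mem_nhds hxy
    filter_upwards [mem_nhdsWithin_of_mem_nhds (h2.and h3)] with z hz
    have := rD_le_slope hf hz.2
    rw [slope_def_field] at this
    exact this.trans_lt hz.1

lemma conv_of_support {g : ℝ → ℝ} (h : ∀ w, ∃ m, ∀ u, g w + m * (u - w) ≤ g u) :
    ConvexOn ℝ univ g := by
  refine ⟨convex_univ, ?_⟩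
  intro x _ y _ a b ha hb hab
  simp only [smul_eq_mul]
  obtain ⟨m, hm⟩ := h (a * x + b * y)
  have h1 := mul_le_mul_of_nonneg_left (hm x) ha
  have h2 := mul_le_mul_of_nonneg_left (hm y) hb
  have hb' : b = 1 - a := by linarith
  subst hb'
  nlinarith

lemma conv_sub_affine {f : ℝ → ℝ} (hf : ConvexOn ℝ univ f) (p q r : ℝ) :
    ConvexOn ℝ univ (fun u => f u - (p + q * (u - r))) := by
  apply conv_of_support
  intro w
  refine ⟨rD f w - q, fun u => ?_⟩
  have := rD_support hf w u
  nlinarith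

lemma hull_sub_convex {F G c : ℝ → ℝ} (hF : ConvexOn ℝ univ F) (hG : ConvexOn ℝ univ G)
    (hc : IsConvexHull (fun k => G k - F k) c) : ConvexOn ℝ univ (fun k => G k - c k) := by
  obtain ⟨hcc, hcl, hcm⟩ := hc
  refine LinearOrder.convexOn_of_lt convex_univ ?_
  intro x _ y _ hxy a b ha hb hab
  set s : ℝ := ((G y - c y) - (G x - c x)) / (y - x) with hs
  have hsy : (G x - c x) + s * (y - x) = G y - c y := by
    rw [hs, div_mul_cancel₀ _ (by linarith : y - x ≠ 0)]; ring
  set l : ℝ → ℝ := fun u => (G x - c x) + s * (u - x) with hl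
  have hlx : l x = G x - c x := by simp [hl]
  have hly : l y = G y - c y := hsy
  -- F ≤ l on [x,y]
  have hFl : ∀ u ∈ Icc x y, F u ≤ l u := by
    intro u hu
    have := (conv_sub_affine hF (G x - c x) s x).le_max_of_mem_Icc (mem_univ x) (mem_univ y) hu
    have h1 : F x - l x ≤ 0 := by have := hcl x; simp only at this; linarith
    have h2 : F y - l y ≤ 0 := by have := hcl y; simp only at this; linarith
    have h3 : F u - l u ≤ max (F x - l x) (F y - l y) := this
    have := h3.trans (max_le h1 h2)
    linarith
  have hGl : ConvexOn ℝ univ (fun u => G u - l u) := conv_sub_affine hG _ _ _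
  classical
  set g : ℝ → ℝ := fun u => if u ∈ Icc x y then max (c u) (G u - l u) else c u with hg
  have hgc : ∀ u, c u ≤ g u := by
    intro u; simp only [hg]; split_ifs
    · exact le_max_left _ _
    · exact le_rfl
  have hgG : ∀ u ∈ Icc x y, G u - l u ≤ g u := by
    intro u hu; simp only [hg, if_pos hu]; exact le_max_right _ _
  have hgconv : ConvexOn ℝ univ g := by
    apply conv_of_support
    intro w
    by_cases hw : g w = c w
    · refine ⟨rD c w, fun u => ?_⟩
      rw [hw]
      exact (rD_support hcc w u).trans (hgc u)
    · have hwI : w ∈ Icc x y := by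
        by_contra h
        exact hw (by simp only [hg, if_neg h])
      have hgw : g w = G w - l w ∧ c w < G w - l w := by
        simp only [hg, if_pos hwI] at hw ⊢
        rcases le_total (c w) (G w - l w) with h | h
        · rw [max_eq_right h] at hw ⊢
          exact ⟨rfl, lt_of_le_of_ne h (Ne.symm hw)⟩
        · exact absurd (max_eq_left h) hw
      set m := rD (fun u => G u - l u) w
      have hm : ∀ u, g w + m * (u - w) ≤ G u - l u := by
        intro u; rw [hgw.1]; exact rD_support hGl w u
      refine ⟨m, fun u => ?_⟩
      by_cases hu : u ∈ Icc x y
      · exact (hm u).trans (hgG u hu)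
      · refine le_trans ?_ (hgc u)
        have hcs := conv_sub_affine hcc (g w) m w
        by_contra hlt
        push Not at hlt
        have hw0 : c w - (g w + m * (w - w)) < 0 := by
          rw [hgw.1]; simp; linarith [hgw.2]
        have hu0 : c u - (g w + m * (u - w)) < 0 := by linarith
        rcases lt_or_ge u x with h | h
        · have h1 : c x - (g w + m * (x - w)) ≤ max (c u - (g w + m * (u - w))) (c w - (g w + m * (w - w))) :=
            hcs.le_max_of_mem_Icc (mem_univ u) (mem_univ w) ⟨h.le, hwI.1⟩
          have h2 := h1.trans_lt (max_lt hu0 hw0)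
          have := hm x
          linarith
        · have h' : y < u := by
            by_contra h3
            exact hu ⟨h, not_lt.1 h3⟩
          have h1 : c y - (g w + m * (y - w)) ≤ max (c w - (g w + m * (w - w))) (c u - (g w + m * (u - w))) :=
            hcs.le_max_of_mem_Icc (mem_univ w) (mem_univ u) ⟨hwI.2, h'.le⟩
          have h2 := h1.trans_lt (max_lt hw0 hu0)
          have := hm y
          linarith
  have hgD : ∀ u, g u ≤ G u - F u := by
    intro u
    simp only [hg]
    split_ifs with hu
    · exact max_le (hcl u) (by linarith [hFl u hu])
    · exact hcl u
  have hle := hcm g hgconv hgD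
  have hz : a * x + b * y ∈ Icc x y := by
    have hb' : b = 1 - a := by linarith
    subst hb'
    constructor <;> nlinarith
  have h1 := (hgG _ hz).trans (hle _)
  have h2 : l (a * x + b * y) = a * l x + b * l y := by
    have hb' : b = 1 - a := by linarith
    simp only [hl]; subst hb'; ring
  rw [h2, hlx, hly] at h1
  simp only [smul_eq_mul]
  linarith

/-- Comparison through right derivatives. -/
lemma right_cmp {f g f' g' : ℝ → ℝ} (hf : Continuous f) (hg : Continuous g)
    (hf' : ∀ x, HasDerivWithinAt f (f' x) (Ici x) x)
    (hg' : ∀ x, HasDerivWithinAt g (g' x) (Ici x) x) {a b : ℝ} (hab : a ≤ b)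
    (h : ∀ x ∈ Ico a b, f' x ≤ g' x) : f b - f a ≤ g b - g a := by
  have := image_le_of_deriv_right_le_deriv_boundary (f := f) (f' := f') (a := a) (b := b)
    (B := fun x => g x + (f a - g a)) (B' := g') hf.continuousOn (fun x _ => hf' x) (by simp)
    (by fun_prop) (fun x _ => (hg' x).add_const _) h (right_mem_Icc.2 hab)
  linarith

lemma right_eq {f g f' : ℝ → ℝ} (hf : Continuous f) (hg : Continuous g)
    (hf' : ∀ x, HasDerivWithinAt f (f' x) (Ici x) x)
    (hg' : ∀ x, HasDerivWithinAt g (f' x) (Ici x) x) (a b : ℝ) : f b - f a = g b - g a := by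
  rcases le_total a b with h | h
  · exact le_antisymm (right_cmp hf hg hf' hg' h fun _ _ => le_rfl)
      (right_cmp hg hf hg' hf' h fun _ _ => le_rfl)
  · have := le_antisymm (right_cmp hf hg hf' hg' h fun _ _ => le_rfl)
      (right_cmp hg hf hg' hf' h fun _ _ => le_rfl)
    linarith

/-! ### Potentials -/

section potentials

variable {μ : Measure ℝ} [IsFiniteMeasure μ]

lemma int_put (hi : Integrable (fun x => x) μ) (k : ℝ) :
    Integrable (fun x => max (k - x) 0) μ :=
  ((integrable_const k).sub hi).pos_part

lemma int_call (hi : Integrable (fun x => x) μ) (k : ℝ) :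
    Integrable (fun x => max (x - k) 0) μ :=
  (hi.sub (integrable_const k)).pos_part

lemma pot_nonneg (μ : Measure ℝ) (k : ℝ) : 0 ≤ pot μ k :=
  integral_nonneg fun _ => le_max_right _ _

lemma cpot_nonneg (μ : Measure ℝ) (k : ℝ) : 0 ≤ cpot μ k :=
  integral_nonneg fun _ => le_max_right _ _

lemma pot_conv (hi : Integrable (fun x => x) μ) : ConvexOn ℝ univ (pot μ) := by
  refine ⟨convex_univ, ?_⟩
  intro x _ y _ a b ha hb hab
  simp only [smul_eq_mul, pot]
  rw [← integral_const_mul, ← integral_const_mul,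
    ← integral_add ((int_put hi x).const_mul a) ((int_put hi y).const_mul b)]
  apply integral_mono (int_put hi _) (((int_put hi x).const_mul a).add ((int_put hi y).const_mul b))
  intro z
  have hb' : b = 1 - a := by linarith
  subst hb'
  have h1 := mul_le_mul_of_nonneg_left (le_max_left (x - z) 0) ha
  have h2 := mul_le_mul_of_nonneg_left (le_max_left (y - z) 0) hb
  have h3 := mul_le_mul_of_nonneg_left (le_max_right (x - z) 0) ha
  have h4 := mul_le_mul_of_nonneg_left (le_max_right (y - z) 0) hb
  refine max_le ?_ ?_
  · simp only [Pi.add_apply]; nlinarith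
  · simp only [Pi.add_apply]; nlinarith

lemma pot_eq (hi : Integrable (fun x => x) μ) (k : ℝ) :
    pot μ k = (μ univ).toReal * k - ∫ x, x ∂μ + cpot μ k := by
  have h : ∀ x, max (k - x) 0 = (k - x) + max (x - k) 0 := by
    intro x
    rcases le_total x k with h | h
    · rw [max_eq_left (by linarith), max_eq_right (by linarith)]; ring
    · rw [max_eq_right (by linarith), max_eq_left (by linarith)]; ring
  unfold pot cpot
  simp_rw [h]
  have hk : Integrable (fun x : ℝ => k - x) μ := (integrable_const k).sub hi
  rw [integral_add hk (int_call hi k), integral_sub (integrable_const k) hi]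
  simp [Measure.real]

lemma pot_tendsto (hi : Integrable (fun x => x) μ) : Tendsto (pot μ) atBot (nhds 0) := by
  have : Tendsto (pot μ) atBot (nhds (∫ _x, (0 : ℝ) ∂μ)) := by
    apply tendsto_integral_filter_of_dominated_convergence (fun x => |x|)
    · exact Eventually.of_forall fun k => (int_put hi k).aestronglyMeasurable
    · filter_upwards [eventually_le_atBot (0 : ℝ)] with k hk
      refine Eventually.of_forall fun x => ?_
      rw [Real.norm_eq_abs, abs_of_nonneg (le_max_right _ _)]
      exact max_le (by linarith [neg_abs_le x]) (abs_nonneg _)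
    · exact hi.abs
    · refine Eventually.of_forall fun x => ?_
      apply tendsto_const_nhds.congr'
      filter_upwards [eventually_le_atBot x] with k hk
      rw [max_eq_right (by linarith)]
  simpa using this

lemma cpot_tendsto (hi : Integrable (fun x => x) μ) : Tendsto (cpot μ) atTop (nhds 0) := by
  have : Tendsto (cpot μ) atTop (nhds (∫ _x, (0 : ℝ) ∂μ)) := by
    apply tendsto_integral_filter_of_dominated_convergence (fun x => |x|)
    · exact Eventually.of_forall fun k => (int_call hi k).aestronglyMeasurable
    · filter_upwards [eventually_ge_atTop (0 : ℝ)] with k hk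
      refine Eventually.of_forall fun x => ?_
      rw [Real.norm_eq_abs, abs_of_nonneg (le_max_right _ _)]
      exact max_le (by linarith [le_abs_self x]) (abs_nonneg _)
    · exact hi.abs
    · refine Eventually.of_forall fun x => ?_
      apply tendsto_const_nhds.congr'
      filter_upwards [eventually_ge_atTop x] with k hk
      rw [max_eq_right (by linarith)]
  simpa using this

lemma pot_slope_bounds (hi : Integrable (fun x => x) μ) {x y : ℝ} (hxy : x < y) :
    μ.real (Iic x) * (y - x) ≤ pot μ y - pot μ x ∧
      pot μ y - pot μ x ≤ μ.real (Iic y) * (y - x) := by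
  have hd : pot μ y - pot μ x = ∫ z, (max (y - z) 0 - max (x - z) 0) ∂μ :=
    (integral_sub (int_put hi y) (int_put hi x)).symm
  have hI : ∀ w : ℝ, μ.real (Iic w) * (y - x) = ∫ z, (Iic w).indicator (fun _ => y - x) z ∂μ := by
    intro w
    rw [integral_indicator_const _ measurableSet_Iic, smul_eq_mul]
  have hii : ∀ w : ℝ, Integrable ((Iic w).indicator (fun _ => y - x)) μ := fun w =>
    (integrable_const _).indicator measurableSet_Iic
  rw [hd, hI, hI]
  constructor
  · apply integral_mono (hii x) ((int_put hi y).sub (int_put hi x))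
    intro z
    by_cases hz : z ≤ x
    · simp only [indicator_of_mem (mem_Iic.2 hz), Pi.sub_apply]
      rw [max_eq_left (by linarith), max_eq_left (by linarith)]; linarith
    · simp only [indicator_of_notMem (fun h => hz (mem_Iic.1 h)), Pi.sub_apply]
      rw [max_eq_right (by linarith : x - z ≤ 0)]
      simp
  · apply integral_mono ((int_put hi y).sub (int_put hi x)) (hii y)
    intro z
    by_cases hz : z ≤ y
    · simp only [indicator_of_mem (mem_Iic.2 hz), Pi.sub_apply]
      rw [max_eq_left (by linarith)]
      linarith [le_max_left (x - z) 0]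
    · simp only [indicator_of_notMem (fun h => hz (mem_Iic.1 h)), Pi.sub_apply]
      push Not at hz
      rw [max_eq_right (by linarith : x - z ≤ 0), max_eq_right (by linarith)]
      simp

lemma real_Iic_rc (x : ℝ) : Tendsto (fun y => μ.real (Iic y)) (nhdsWithin x (Ioi x))
    (nhds (μ.real (Iic x))) := by
  have h : Tendsto (fun y => μ (Iic y)) (nhdsWithin x (Ioi x)) (nhds (μ (Iic x))) := by
    have hh : Iic x = ⋂ r > x, Iic r := by
      ext z; simp only [mem_Iic, mem_iInter]
      exact ⟨fun h r hr => h.trans (le_of_lt hr), fun h => le_of_forall_gt_imp_ge_of_dense h⟩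
    rw [hh]
    apply tendsto_measure_biInter_gt
    · intro r _; exact measurableSet_Iic.nullMeasurableSet
    · intro i j _ hij; exact Iic_subset_Iic.2 hij
    · exact ⟨x + 1, by simp, measure_ne_top _ _⟩
  exact (ENNReal.tendsto_toReal (measure_ne_top _ _)).comp h

lemma pot_hasDeriv (hi : Integrable (fun x => x) μ) (x : ℝ) :
    HasDerivWithinAt (pot μ) (μ.real (Iic x)) (Ici x) x := by
  refine HasDerivWithinAt.Ici_of_Ioi ?_
  rw [hasDerivWithinAt_iff_tendsto_slope' self_notMem_Ioi]
  refine tendsto_of_tendsto_of_tendsto_of_le_of_le' tendsto_const_nhds (real_Iic_rc x) ?_ ?_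
  · filter_upwards [self_mem_nhdsWithin] with y hy
    have hy : x < y := hy
    rw [slope_def_field, le_div_iff₀ (by linarith)]
    exact (pot_slope_bounds hi hy).1
  · filter_upwards [self_mem_nhdsWithin] with y hy
    have hy : x < y := hy
    rw [slope_def_field, div_le_iff₀ (by linarith)]
    exact (pot_slope_bounds hi hy).2

lemma pot_mono (hi : Integrable (fun x => x) μ) : Monotone (pot μ) := by
  intro x y hxy
  apply integral_mono (int_put hi x) (int_put hi y)
  intro z
  exact max_le_max (by linarith) le_rfl

lemma pot_inj {η : Measure ℝ} [IsFiniteMeasure η] (hi : Integrable (fun x => x) μ)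
    (hj : Integrable (fun x => x) η) (h : ∀ k, pot μ k = pot η k) : μ = η := by
  have h' : pot μ = pot η := funext h
  apply Measure.ext_of_Iic
  intro a
  have h1 := (pot_hasDeriv hi a).derivWithin (uniqueDiffWithinAt_Ici a)
  have h2 := (pot_hasDeriv hj a).derivWithin (uniqueDiffWithinAt_Ici a)
  rw [h', h2] at h1
  exact ((measureReal_eq_measureReal_iff (measure_ne_top _ _) (measure_ne_top _ _)).1 h1).symm

/-- Fubini for potentials. -/
lemma fub {σ : Measure ℝ} [IsFiniteMeasure σ] (hi : Integrable (fun x => x) μ)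
    (hs : Integrable (fun x => x) σ) :
    Integrable (pot σ) μ ∧ ∫ x, pot σ x ∂μ = ∫ k, cpot μ k ∂σ := by
  have hI : Integrable (fun p : ℝ × ℝ => max (p.1 - p.2) 0) (μ.prod σ) :=
    ((hi.comp_fst σ).sub (hs.comp_snd μ)).pos_part
  refine ⟨hI.integral_prod_left, ?_⟩
  exact integral_integral_swap hI

lemma int_cpot {σ : Measure ℝ} [IsFiniteMeasure σ] (hi : Integrable (fun x => x) μ)
    (hs : Integrable (fun x => x) σ) : Integrable (cpot μ) σ := by
  have hI : Integrable (fun p : ℝ × ℝ => max (p.1 - p.2) 0) (μ.prod σ) :=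
    ((hi.comp_fst σ).sub (hs.comp_snd μ)).pos_part
  exact hI.integral_prod_right

end potentials

lemma ecx_int {μ ν : Measure ℝ} (hE : ECx μ ν) {f : ℝ → ℝ} (hf : ConvexOn ℝ univ f)
    (h0 : ∀ x, 0 ≤ f x) (h1 : Integrable f μ) (h2 : Integrable f ν) :
    ∫ x, f x ∂μ ≤ ∫ x, f x ∂ν := by
  rw [integral_eq_lintegral_of_nonneg_ae (Eventually.of_forall h0) h1.aestronglyMeasurable,
    integral_eq_lintegral_of_nonneg_ae (Eventually.of_forall h0) h2.aestronglyMeasurable]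
  refine ENNReal.toReal_mono ?_ (hE f hf h0)
  have := h2.lintegral_lt_top
  exact this.ne

lemma put_conv (k : ℝ) : ConvexOn ℝ univ (fun x : ℝ => max (k - x) 0) := by
  apply conv_of_support
  intro w
  rcases le_total w k with h | h
  · refine ⟨-1, fun u => ?_⟩
    rw [max_eq_left (by linarith)]
    linarith [le_max_left (k - u) 0]
  · refine ⟨0, fun u => ?_⟩
    rw [max_eq_right (by linarith)]
    linarith [le_max_right (k - u) 0]

lemma call_conv (k : ℝ) : ConvexOn ℝ univ (fun x : ℝ => max (x - k) 0) := by
  apply conv_of_support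
  intro w
  rcases le_total k w with h | h
  · refine ⟨1, fun u => ?_⟩
    rw [max_eq_left (by linarith)]
    linarith [le_max_left (u - k) 0]
  · refine ⟨0, fun u => ?_⟩
    rw [max_eq_right (by linarith)]
    linarith [le_max_right (u - k) 0]

/-! ### Convex order from potentials -/

/-- The right derivative of a convex function as a Stieltjes function. -/
noncomputable def cS {f : ℝ → ℝ} (hf : ConvexOn ℝ univ f) : StieltjesFunction ℝ :=
  ⟨rD f, rD_mono hf, rD_rc hf⟩

lemma trunc {f : ℝ → ℝ} (hf : ConvexOn ℝ univ f) {N : ℝ} (hN : 0 ≤ N) :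
    ∃ (σ : Measure ℝ) (A B : ℝ), IsFiniteMeasure σ ∧ Integrable (fun x => x) σ ∧
      (∀ x ∈ Icc (-N) N, pot σ x + (A * x + B) = f x) ∧
      (∀ x, pot σ x + (A * x + B) ≤ f x) ∧
      (∀ x, f 0 + rD f 0 * (x - 0) ≤ pot σ x + (A * x + B)) := by
  set σ : Measure ℝ := (cS hf).measure.restrict (Ioc (-N) N) with hσ
  have hfin : IsFiniteMeasure σ := by
    refine ⟨?_⟩
    rw [hσ, Measure.restrict_apply_univ, StieltjesFunction.measure_Ioc]
    exact ENNReal.ofReal_lt_top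
  have hint : Integrable (fun x => x) σ := by
    refine Integrable.of_bound (C := N) aestronglyMeasurable_id ?_
    rw [hσ, ae_restrict_iff' measurableSet_Ioc]
    refine Eventually.of_forall fun x hx => ?_
    rw [Real.norm_eq_abs, abs_le]
    exact ⟨hx.1.le, hx.2⟩
  have hIic : ∀ x, σ.real (Iic x) = rD f (max (min x N) (-N)) - rD f (-N) := by
    intro x
    have h1 : Iic x ∩ Ioc (-N) N = Ioc (-N) (max (min x N) (-N)) := by
      ext z
      simp only [mem_inter_iff, mem_Iic, mem_Ioc, le_max_iff, le_min_iff]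
      constructor
      · rintro ⟨a, b, c⟩; exact ⟨b, Or.inl ⟨a, c⟩⟩
      · rintro ⟨a, b | b⟩
        · exact ⟨b.1, a, b.2⟩
        · exact absurd a (not_lt.2 b)
    rw [Measure.real, hσ, Measure.restrict_apply measurableSet_Iic, h1,
      StieltjesFunction.measure_Ioc, ENNReal.toReal_ofReal]
    · rfl
    · exact sub_nonneg.2 (rD_mono hf (le_max_right _ _))
  refine ⟨σ, rD f (-N), f 0 - pot σ 0, hfin, hint, ?_⟩
  set F : ℝ → ℝ := fun x => pot σ x + (rD f (-N) * x + (f 0 - pot σ 0)) with hF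
  have hFc : Continuous F := by
    have := conv_cont (pot_conv hint)
    fun_prop
  have hF' : ∀ x, HasDerivWithinAt F (rD f (max (min x N) (-N))) (Ici x) x := by
    intro x
    have h1 := (pot_hasDeriv hint x).add
      ((((hasDerivWithinAt_id x (Ici x)).const_mul (rD f (-N)))).add_const (f 0 - pot σ 0))
    rw [hIic] at h1
    exact h1.congr_deriv (by ring)
  have hF0 : F 0 = f 0 := by simp [hF]
  have hfc := conv_cont hf
  have hf' := rD_hasDeriv hf
  have hmon := rD_mono hf
  have hle : ∀ x, F x ≤ f x := by
    intro x
    rcases le_total 0 x with h | h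
    · have := right_cmp hFc hfc hF' hf' h fun y hy => hmon
        (max_le (min_le_left _ _) (by linarith [hy.1]))
      linarith
    · have := right_cmp hfc hFc hf' hF' h fun y hy => hmon
        (le_max_of_le_left (le_min le_rfl (by linarith [hy.2])))
      linarith
  refine ⟨?_, hle, ?_⟩
  · intro x hx
    refine le_antisymm (hle x) ?_
    change f x ≤ F x
    rcases le_total 0 x with h | h
    · have := right_cmp hfc hFc hf' hF' h fun y hy => hmon
        (le_max_of_le_left (le_min le_rfl (by linarith [hy.2, hx.2])))
      linarith
    · have := right_cmp hFc hfc hF' hf' h fun y hy => hmon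
        (max_le (min_le_left _ _) (by linarith [hy.1, hx.1]))
      linarith
  · intro x
    change _ ≤ F x
    have hl' : ∀ x, HasDerivWithinAt (fun x => rD f 0 * x) (rD f 0) (Ici x) x := by
      intro x
      simpa using (hasDerivWithinAt_id x (Ici x)).const_mul (rD f 0)
    rcases le_total 0 x with h | h
    · have := right_cmp (by fun_prop) hFc hl' hF' h fun y hy => hmon
        (le_max_of_le_left (le_min hy.1 hN))
      linarith
    · have := right_cmp hFc (by fun_prop) hF' hl' h fun y hy => hmon
        (max_le ((min_le_left _ _).trans hy.2.le) (by linarith))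
      linarith

lemma cx_of_pot {μ η : Measure ℝ} [IsFiniteMeasure μ] [IsFiniteMeasure η]
    (hi : Integrable (fun x => x) μ) (hj : Integrable (fun x => x) η)
    (hm : (μ univ).toReal = (η univ).toReal) (hb : ∫ x, x ∂μ = ∫ x, x ∂η)
    (hp : ∀ k, pot μ k ≤ pot η k) : Cx μ η := by
  intro f hf hfμ hfη
  have hcp : ∀ k, cpot μ k ≤ cpot η k := by
    intro k
    have h1 := pot_eq hi k
    have h2 := pot_eq hj k
    have h3 := hp k
    rw [hm, hb] at h1
    linarith
  choose σ A B hfin hint heq hle hge using fun n : ℕ => trunc hf (Nat.cast_nonneg (α := ℝ) n)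
  have key : ∀ (χ : Measure ℝ) [IsFiniteMeasure χ], Integrable (fun x => x) χ → Integrable f χ →
      Tendsto (fun n => ∫ x, (pot (σ n) x + (A n * x + B n)) ∂χ) atTop (nhds (∫ x, f x ∂χ)) := by
    intro χ _ hχ hfχ
    apply tendsto_integral_of_dominated_convergence
      (fun x => |f x| + |f 0 + rD f 0 * (x - 0)|)
    · intro n
      have := conv_cont (pot_conv (hint n))
      exact (by fun_prop : Continuous fun x => pot (σ n) x + (A n * x + B n)).aestronglyMeasurable
    · apply hfχ.abs.add
      apply Integrable.abs
      exact (integrable_const _).add ((hχ.sub (integrable_const 0)).const_mul _)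
    · intro n
      refine Eventually.of_forall fun x => ?_
      rw [Real.norm_eq_abs, abs_le]
      have h1 := hle n x
      have h2 := hge n x
      have h3 := neg_abs_le (f 0 + rD f 0 * (x - 0))
      have h4 := le_abs_self (f x)
      have h5 := abs_nonneg (f x)
      have h6 := abs_nonneg (f 0 + rD f 0 * (x - 0))
      constructor <;> linarith
    · refine Eventually.of_forall fun x => ?_
      apply tendsto_const_nhds.congr'
      obtain ⟨M, hM⟩ := exists_nat_ge |x|
      filter_upwards [eventually_ge_atTop M] with n hn
      have : |x| ≤ n := hM.trans (by exact_mod_cast hn)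
      exact (heq n x (abs_le.1 this)).symm
  have ev : ∀ (χ : Measure ℝ) [IsFiniteMeasure χ], Integrable (fun x => x) χ → ∀ n,
      ∫ x, (pot (σ n) x + (A n * x + B n)) ∂χ =
        ∫ k, cpot χ k ∂(σ n) + (A n * ∫ x, x ∂χ + B n * (χ univ).toReal) := by
    intro χ _ hχ n
    have hA : Integrable (fun x => A n * x) χ := hχ.const_mul _
    have hAB : Integrable (fun x => A n * x + B n) χ := hA.add (integrable_const _)
    rw [integral_add (fub hχ (hint n)).1 hAB, (fub hχ (hint n)).2,
      integral_add hA (integrable_const _), integral_const_mul]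
    simp [Measure.real, mul_comm]
  refine le_of_tendsto_of_tendsto' (key μ hi hfμ) (key η hj hfη) fun n => ?_
  rw [ev μ hi n, ev η hj n, hm, hb]
  have := integral_mono (int_cpot hi (hint n)) (int_cpot hj (hint n)) hcp
  linarith

/-- Asymptotic lines are unique. -/
lemma line_unique {a b a' b' : ℝ} {f : ℝ → ℝ}
    (h : Tendsto (fun z => f z - (a * z - b)) atTop (nhds 0))
    (h' : Tendsto (fun z => f z - (a' * z - b')) atTop (nhds 0)) : a = a' ∧ b = b' := by
  have h1 : Tendsto (fun z => (a' - a) * z - (b' - b)) atTop (nhds 0) := by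
    have := h.sub h'
    simp only [sub_zero] at this
    refine this.congr fun z => ?_
    ring
  have h2 : Tendsto (fun z : ℝ => (a' - a) * (z + 1) - (b' - b)) atTop (nhds 0) :=
    h1.comp (tendsto_atTop_add_const_right _ 1 tendsto_id)
  have h3 : Tendsto (fun _ : ℝ => a' - a) atTop (nhds 0) := by
    have := h2.sub h1
    simp only [sub_zero] at this
    refine this.congr fun z => ?_
    ring
  have ha : a' - a = 0 := tendsto_nhds_unique tendsto_const_nhds h3
  simp only [ha, zero_mul, zero_sub] at h1
  have hb := tendsto_nhds_unique tendsto_const_nhds h1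
  constructor <;> linarith

lemma conv_monotone {f : ℝ → ℝ} (hf : ConvexOn ℝ univ f) (h0 : Tendsto f atBot (nhds 0)) :
    ∀ x, 0 ≤ rD f x := by
  intro x
  by_contra hlt
  push Not at hlt
  have h1 : Tendsto (fun u => f x + rD f x * (u - x)) atBot atTop := by
    apply tendsto_atTop_add_const_left
    apply Tendsto.const_mul_atBot_of_neg hlt
    exact tendsto_atBot_add_const_right _ (-x) tendsto_id
  exact not_tendsto_nhds_of_tendsto_atTop
    (tendsto_atTop_mono (fun u => rD_support hf x u) h1) 0 h0

theorem stmt13 (mu nu : Measure ℝ) [IsFiniteMeasure mu] [IsFiniteMeasure nu]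
    (hintm : Integrable (fun x => x) mu) (hintn : Integrable (fun x => x) nu)
    (hE : ECx mu nu) (c : ℝ → ℝ)
    (hc : IsConvexHull (fun k => pot nu k - pot mu k) c) :
    ConvexOn ℝ Set.univ (fun k => pot nu k - c k) ∧
    (∀ k, pot mu k ≤ pot nu k - c k) ∧
    MemD (mu Set.univ).toReal (∫ x, x ∂mu) (fun k => pot nu k - c k) ∧
    ConvexOn ℝ Set.univ c ∧
    (∃! eta : Measure ℝ, IsFiniteMeasure eta ∧ Integrable (fun x => x) eta ∧
      (∀ k, pot eta k = pot nu k - c k) ∧ Cx mu eta ∧ eta ≤ nu) := by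
  have hcv := hc.1
  have hcl : ∀ k, c k ≤ pot nu k - pot mu k := hc.2.1
  have hh : ConvexOn ℝ Set.univ (fun k => pot nu k - c k) :=
    hull_sub_convex (pot_conv hintm) (pot_conv hintn) hc
  set h : ℝ → ℝ := fun k => pot nu k - c k with hdef
  have hD0 : ∀ k, pot mu k ≤ pot nu k := fun k =>
    ecx_int hE (put_conv k) (fun _ => le_max_right _ _) (int_put hintm k) (int_put hintn k)
  have hDc : ∀ k, cpot mu k ≤ cpot nu k := fun k =>
    ecx_int hE (call_conv k) (fun _ => le_max_right _ _) (int_call hintm k) (int_call hintn k)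
  have hc0 : ∀ k, 0 ≤ c k := hc.2.2 (fun _ => 0) (convexOn_const 0 convex_univ)
    (fun k => by simpa using hD0 k)
  have hcL : ∀ k, ((nu univ).toReal - (mu univ).toReal) * k
      - ((∫ x, x ∂nu) - ∫ x, x ∂mu) ≤ c k := by
    refine hc.2.2 (fun k => ((nu univ).toReal - (mu univ).toReal) * k
      - ((∫ x, x ∂nu) - ∫ x, x ∂mu)) ?_ ?_
    · apply conv_of_support
      intro w
      exact ⟨(nu univ).toReal - (mu univ).toReal, fun u => le_of_eq (by ring)⟩
    · intro k
      simp only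
      rw [pot_eq hintm k, pot_eq hintn k]
      linarith [hDc k]
  have hle : ∀ k, pot mu k ≤ h k := fun k => by simp only [hdef]; linarith [hcl k]
  have h0 : ∀ k, 0 ≤ h k := fun k => (pot_nonneg mu k).trans (hle k)
  have hbot : Tendsto h atBot (nhds 0) :=
    tendsto_of_tendsto_of_tendsto_of_le_of_le tendsto_const_nhds (pot_tendsto hintn) h0
      (fun k => by simp only [hdef]; linarith [hc0 k])
  have hr0 := conv_monotone hh hbot
  have hmono : Monotone h := by
    intro x y hxy
    have h1 := rD_support hh x y
    have h2 := mul_nonneg (hr0 x) (sub_nonneg.2 hxy)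
    linarith
  have htop : Tendsto (fun z => h z - ((mu univ).toReal * z - ∫ x, x ∂mu)) atTop (nhds 0) := by
    refine tendsto_of_tendsto_of_tendsto_of_le_of_le tendsto_const_nhds (cpot_tendsto hintn) ?_ ?_
    · intro z
      have h1 := hle z
      have h2 := pot_eq hintm z
      have h3 := cpot_nonneg mu z
      simp only
      linarith
    · intro z
      have h1 := hcL z
      have h2 := pot_eq hintn z
      simp only [hdef]
      linarith
  refine ⟨hh, hle, ⟨hh, hmono, h0, hbot, htop⟩, hcv, ?_⟩
  -- the measure
  have hsum : ∀ x, rD h x + rD c x = nu.real (Iic x) := by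
    intro x
    have h1 := (rD_hasDeriv hh x).add (rD_hasDeriv hcv x)
    have h2 : h + c = pot nu := by
      funext k; simp [hdef]
    rw [h2] at h1
    have h3 := h1.derivWithin (uniqueDiffWithinAt_Ici x)
    have h4 := (pot_hasDeriv hintn x).derivWithin (uniqueDiffWithinAt_Ici x)
    rw [← h3, ← h4]
  have hnu : (cS hh).measure + (cS hcv).measure = nu := by
    symm
    apply Measure.ext_of_Ioc
    intro a b hab
    have h1 : nu.real (Ioc a b) = nu.real (Iic b) - nu.real (Iic a) := by
      rw [show Ioc a b = Iic b \ Iic a by ext z; simp [and_comm],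
        measureReal_diff (Iic_subset_Iic.2 hab.le) measurableSet_Iic]
    rw [Measure.add_apply, StieltjesFunction.measure_Ioc, StieltjesFunction.measure_Ioc,
      ← ENNReal.ofReal_add (sub_nonneg.2 ((cS hh).mono hab.le))
        (sub_nonneg.2 ((cS hcv).mono hab.le)),
      ← ofReal_measureReal (measure_ne_top nu _), h1, ← hsum, ← hsum]
    congr 1
    change _ = (rD h b - rD h a) + (rD c b - rD c a)
    ring
  set eta : Measure ℝ := (cS hh).measure with heta
  have hetale : eta ≤ nu := by
    rw [← hnu]; exact Measure.le_add_right le_rfl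
  have hfin : IsFiniteMeasure eta := isFiniteMeasure_of_le nu hetale
  have hint : Integrable (fun x => x) eta := hintn.mono_measure hetale
  have hrbot : Tendsto (cS hh) atBot (nhds 0) := by
    have h1 : Tendsto (fun x => h (x + 1) - h x) atBot (nhds 0) := by
      have := (hbot.comp (tendsto_atBot_add_const_right _ (1 : ℝ) tendsto_id)).sub hbot
      simpa using this
    refine tendsto_of_tendsto_of_tendsto_of_le_of_le tendsto_const_nhds h1 hr0 ?_
    intro x
    have := rD_support hh x (x + 1)
    change rD h x ≤ _
    simp only
    linarith
  have hIic : ∀ x, eta.real (Iic x) = rD h x := by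
    intro x
    rw [Measure.real, heta, StieltjesFunction.measure_Iic _ hrbot, sub_zero]
    exact ENNReal.toReal_ofReal (hr0 x)
  have hpot : ∀ k, pot eta k = h k := by
    intro k
    have h1 : ∀ a, pot eta k - pot eta a = h k - h a := fun a =>
      right_eq (f' := rD h) (conv_cont (pot_conv hint)) (conv_cont hh)
        (fun x => hIic x ▸ pot_hasDeriv hint x) (rD_hasDeriv hh) a k
    have h2 : Tendsto (fun a => pot eta k - pot eta a) atBot (nhds (pot eta k - 0)) :=
      tendsto_const_nhds.sub (pot_tendsto hint)
    have h3 : Tendsto (fun a => h k - h a) atBot (nhds (h k - 0)) :=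
      tendsto_const_nhds.sub hbot
    simp_rw [h1] at h2
    simpa using tendsto_nhds_unique h2 h3
  have hetop : Tendsto (fun z => h z - ((eta univ).toReal * z - ∫ x, x ∂eta)) atTop (nhds 0) := by
    refine (cpot_tendsto hint).congr fun z => ?_
    rw [← hpot z, pot_eq hint z]
    ring
  obtain ⟨hm, hb⟩ := line_unique htop hetop
  refine ⟨eta, ⟨hfin, hint, hpot, cx_of_pot hintm hint hm hb fun k => ?_, hetale⟩, ?_⟩
  · rw [hpot]; exact hle k
  · rintro eta' ⟨hf', hi', hp', -, -⟩
    exact pot_inj hi' hint fun k => by rw [hp' k, hpot k]
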